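/- arXiv:2008.12946 — 6 statements merged into one kernel-verified Lean document; each statement's English description precedes it below -/
import Mathlib

section
/- Let w* = (u*,p*) be a saddle point of the Lagrangian L. For every w = (u,p) ∈ U × ℝᵐ one has Λ(w,w*) ≤ d₂‖w − w*‖² + (ε(N−1)/N)[L(u,p*) − L(u*,p*)], where d₂ = max{ (4N−3)ε/((4N−2)Nρ), (NB + ε(2N−3)γλ_max(AᵀA))/(2N) }. -/
open scoped RealInnerProductSpace

/-- Descent lemma: if the gradient `f'` of `f` is `B`-Lipschitz on a convex set `U`, then the
linearization error of `f` between points of `U` is at most `B / 2 * ‖y - x‖ ^ 2`. -/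
theorem sub_sub_inner_le_of_gradient_lipschitz {E : Type*} [NormedAddCommGroup E]
    [InnerProductSpace ℝ E] [CompleteSpace E] {U : Set E} (hU : Convex ℝ U) {f : E → ℝ}
    {f' : E → E} {B : ℝ} (hf : ∀ x, HasGradientAt f (f' x) x)
    (hLip : ∀ x ∈ U, ∀ y ∈ U, ‖f' x - f' y‖ ≤ B * ‖x - y‖) {x y : E} (hx : x ∈ U) (hy : y ∈ U) :
    f y - f x - ⟪f' x, y - x⟫ ≤ B / 2 * ‖y - x‖ ^ 2 := by
  set d := y - x with hd
  let φ : ℝ → ℝ := fun t => f (x + t • d) - t * ⟪f' x, d⟫ - B / 2 * ‖d‖ ^ 2 * t ^ 2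
  have hφ (t : ℝ) :
      HasDerivAt φ (⟪f' (x + t • d), d⟫ - ⟪f' x, d⟫ - B / 2 * ‖d‖ ^ 2 * (2 * t)) t := by
    have hline : HasDerivAt (fun t : ℝ => x + t • d) d t := by
      simpa using ((hasDerivAt_id t).smul_const d).const_add x
    have hcomp : HasDerivAt (fun t : ℝ => f (x + t • d)) ⟪f' (x + t • d), d⟫ t := by
      have h := (hf (x + t • d)).hasFDerivAt.comp_hasDerivAt t hline
      rw [InnerProductSpace.toDual_apply_apply] at h
      exact h
    have hlin : HasDerivAt (fun t : ℝ => t * ⟪f' x, d⟫) ⟪f' x, d⟫ t := by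
      simpa using (hasDerivAt_id t).mul_const ⟪f' x, d⟫
    have hsq : HasDerivAt (fun t : ℝ => B / 2 * ‖d‖ ^ 2 * t ^ 2) (B / 2 * ‖d‖ ^ 2 * (2 * t)) t := by
      simpa using (hasDerivAt_pow 2 t).const_mul (B / 2 * ‖d‖ ^ 2)
    exact (hcomp.sub hlin).sub hsq
  have hanti : AntitoneOn φ (Set.Icc 0 1) := by
    refine antitoneOn_of_hasDerivWithinAt_nonpos (convex_Icc 0 1)
      (fun t _ => (hφ t).continuousAt.continuousWithinAt)
      (fun t _ => (hφ t).hasDerivWithinAt) fun t ht => ?_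
    rw [interior_Icc] at ht
    have hmem : x + t • d ∈ U := hU.add_smul_sub_mem hx hy ⟨ht.1.le, ht.2.le⟩
    have hbound := hLip _ hmem x hx
    rw [add_sub_cancel_left, norm_smul, Real.norm_of_nonneg ht.1.le] at hbound
    have hinner := real_inner_le_norm (f' (x + t • d) - f' x) d
    rw [inner_sub_left] at hinner
    nlinarith [mul_le_mul_of_nonneg_right hbound (norm_nonneg d)]
  have h := hanti (Set.left_mem_Icc.2 zero_le_one) (Set.right_mem_Icc.2 zero_le_one) zero_le_one
  simp only [φ, one_smul, zero_smul, add_zero, hd, add_sub_cancel] at h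
  linarith

/-- Young's inequality for the real inner product with weight `γ`. -/
theorem real_inner_le_young {E : Type*} [NormedAddCommGroup E] [InnerProductSpace ℝ E]
    {γ : ℝ} (hγ : 0 < γ) (q r : E) :
    ⟪q, r⟫ ≤ 1 / (2 * γ) * ‖q‖ ^ 2 + γ / 2 * ‖r‖ ^ 2 := by
  have hsq : 1 / (2 * γ) * ‖q‖ ^ 2 + γ / 2 * ‖r‖ ^ 2 - ‖q‖ * ‖r‖
      = 1 / (2 * γ) * (‖q‖ - γ * ‖r‖) ^ 2 := by
    field_simp
    ring
  have hnonneg : 0 ≤ 1 / (2 * γ) * (‖q‖ - γ * ‖r‖) ^ 2 := by positivity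
  linarith [real_inner_le_norm q r]

/-- Problem data for the linearly constrained convex program (P):
`min G(u)+J(u) s.t. Au = b, u ∈ U`, together with the core function `K`,
the algorithm parameters, a saddle point `(ustar, pstar)` of the Lagrangian `L`,
the Bregman-like function `D` and the merit function `Λ`. -/
theorem lambda_upper_bound
    (n m : ℕ)
    (U : Set (EuclideanSpace ℝ (Fin n)))
    (hUclosed : IsClosed U) (hUconvex : Convex ℝ U) (hUne : U.Nonempty)
    (G J : EuclideanSpace ℝ (Fin n) → ℝ)
    (G' : EuclideanSpace ℝ (Fin n) → EuclideanSpace ℝ (Fin n))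
    (BG : ℝ)
    (hGconv : ConvexOn ℝ U G)
    (hGdiff : ∀ x, HasGradientAt G (G' x) x)
    (hGLip : ∀ x ∈ U, ∀ y ∈ U, ‖G' x - G' y‖ ≤ BG * ‖x - y‖)
    (hJconv : ConvexOn ℝ U J)
    (hJlsc : LowerSemicontinuous J)
    (A : EuclideanSpace ℝ (Fin n) →L[ℝ] EuclideanSpace ℝ (Fin m))
    (b : EuclideanSpace ℝ (Fin m))
    -- `lam` is the largest eigenvalue of `AᵀA`, i.e. the square of the operator norm of `A`
    (lam : ℝ) (hlam : lam = ‖A‖ ^ 2)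
    (K : EuclideanSpace ℝ (Fin n) → ℝ)
    (K' : EuclideanSpace ℝ (Fin n) → EuclideanSpace ℝ (Fin n))
    (β B : ℝ) (hβ : 0 < β)
    (hKdiff : ∀ x, HasGradientAt K (K' x) x)
    -- strong convexity of `K` with parameter `β` (on `U`)
    (hKstrong : ∀ x ∈ U, ∀ y ∈ U, K x + ⟪K' x, y - x⟫ + β / 2 * ‖y - x‖ ^ 2 ≤ K y)
    -- Lipschitz continuity of `∇K` with constant `B` (on `U`)
    (hKLip : ∀ x ∈ U, ∀ y ∈ U, ‖K' x - K' y‖ ≤ B * ‖x - y‖)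
    (N : ℕ) (hN : 2 ≤ N)
    (γ ε ρ : ℝ) (hγ : 0 < γ)
    (hε : 0 < ε ∧ ε < β / (BG + γ * lam))
    (hρ : 0 < ρ ∧ ρ < 2 * γ / (2 * (N : ℝ) - 1))
    -- the Lagrangian
    (L : EuclideanSpace ℝ (Fin n) → EuclideanSpace ℝ (Fin m) → ℝ)
    (hL : ∀ u p, L u p = G u + J u + ⟪p, A u - b⟫)
    -- the Bregman-like function
    (D : EuclideanSpace ℝ (Fin n) → EuclideanSpace ℝ (Fin n) → ℝ)
    (hD : ∀ x y, D x y = K x - K y - ⟪K' y, x - y⟫)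
    -- a saddle point of `L` on `U × ℝᵐ`
    (ustar : EuclideanSpace ℝ (Fin n)) (pstar : EuclideanSpace ℝ (Fin m))
    (hustar : ustar ∈ U)
    (hsaddle : ∀ u ∈ U, ∀ p : EuclideanSpace ℝ (Fin m),
      L ustar p ≤ L ustar pstar ∧ L ustar pstar ≤ L u pstar)
    -- the function `Λ`
    (Lam : (EuclideanSpace ℝ (Fin n) × EuclideanSpace ℝ (Fin m)) →
      (EuclideanSpace ℝ (Fin n) × EuclideanSpace ℝ (Fin m)) → ℝ)
    (hLam : ∀ w w', Lam w w' = D w'.1 w.1 + ε / (2 * (N : ℝ) * ρ) * ‖w.2 - w'.2‖ ^ 2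
      + ε * ((N : ℝ) - 1) / (N : ℝ) * (L w.1 w.2 - L ustar pstar)
      + ε * ((N : ℝ) - 2) * γ / (2 * (N : ℝ)) * ‖A w.1 - b‖ ^ 2)
    : ∀ u ∈ U, ∀ p : EuclideanSpace ℝ (Fin m),
        Lam (u, p) (ustar, pstar) ≤
          max ((4 * (N : ℝ) - 3) * ε / ((4 * (N : ℝ) - 2) * (N : ℝ) * ρ))
              (((N : ℝ) * B + ε * (2 * (N : ℝ) - 3) * γ * lam) / (2 * (N : ℝ))) *
            (‖u - ustar‖ ^ 2 + ‖p - pstar‖ ^ 2)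
          + ε * ((N : ℝ) - 1) / (N : ℝ) * (L u pstar - L ustar pstar) := by
  intro u hu p
  obtain ⟨hε0, -⟩ := hε
  obtain ⟨hρ0, hρ1⟩ := hρ
  have hN2 : (2 : ℝ) ≤ N := by exact_mod_cast hN
  have hfeas : A ustar = b := by
    have h := (hsaddle ustar hustar (pstar + (A ustar - b))).1
    rw [hL, hL, inner_add_left, real_inner_self_eq_norm_sq] at h
    have h0 : ‖A ustar - b‖ ^ 2 = 0 := le_antisymm (by linarith) (sq_nonneg _)
    exact sub_eq_zero.1 (norm_eq_zero.1 (pow_eq_zero_iff two_ne_zero |>.1 h0))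
  have hD_le : D ustar u ≤ B / 2 * ‖u - ustar‖ ^ 2 := by
    rw [hD, norm_sub_rev]
    exact sub_sub_inner_le_of_gradient_lipschitz hUconvex hKdiff hKLip hu hustar
  have hA_le : ‖A u - b‖ ^ 2 ≤ lam * ‖u - ustar‖ ^ 2 := by
    rw [hlam, ← mul_pow, ← hfeas, ← map_sub]
    exact pow_le_pow_left₀ (norm_nonneg _) (A.le_opNorm _) 2
  have hL_eq : L u p = L u pstar + ⟪p - pstar, A u - b⟫ := by
    rw [hL, hL, inner_sub_left]
    ring
  have hinner : ⟪p - pstar, A u - b⟫ ≤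
      1 / ((2 * (N : ℝ) - 1) * ρ) * ‖p - pstar‖ ^ 2 + γ / 2 * ‖A u - b‖ ^ 2 := by
    refine (real_inner_le_young hγ _ _).trans ?_
    have hden : (2 * (N : ℝ) - 1) * ρ ≤ 2 * γ := by
      rw [lt_div_iff₀ (by linarith)] at hρ1
      linarith
    have hpos : 0 < (2 * (N : ℝ) - 1) * ρ := mul_pos (by linarith) hρ0
    gcongr
  have hc : 0 ≤ ε * ((N : ℝ) - 1) / N := by
    have : 0 ≤ (N : ℝ) - 1 := by linarith
    positivity
  have hc' : 0 ≤ ε * (2 * (N : ℝ) - 3) * γ / (2 * N) := by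
    have : 0 ≤ 2 * (N : ℝ) - 3 := by linarith
    positivity
  set d₁ := (4 * (N : ℝ) - 3) * ε / ((4 * (N : ℝ) - 2) * (N : ℝ) * ρ) with hd₁
  set d₂ := ((N : ℝ) * B + ε * (2 * (N : ℝ) - 3) * γ * lam) / (2 * (N : ℝ)) with hd₂
  have hN0 : (N : ℝ) ≠ 0 := by linarith
  have hN1 : 2 * (N : ℝ) - 1 ≠ 0 := by linarith
  have hd₁_eq : ε / (2 * (N : ℝ) * ρ) + ε * ((N : ℝ) - 1) / N * (1 / ((2 * (N : ℝ) - 1) * ρ))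
      = d₁ := by
    rw [hd₁, show 4 * (N : ℝ) - 2 = 2 * (2 * (N : ℝ) - 1) by ring]
    field_simp
    ring
  have hd₂_eq : B / 2 + ε * (2 * (N : ℝ) - 3) * γ / (2 * N) * lam = d₂ := by
    rw [hd₂]
    field_simp
  have hγ_eq : ε * ((N : ℝ) - 1) / N * (γ / 2) + ε * ((N : ℝ) - 2) * γ / (2 * N)
      = ε * (2 * (N : ℝ) - 3) * γ / (2 * N) := by
    field_simp
    ring
  have hmax : d₁ * ‖p - pstar‖ ^ 2 + d₂ * ‖u - ustar‖ ^ 2 ≤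
      max d₁ d₂ * (‖u - ustar‖ ^ 2 + ‖p - pstar‖ ^ 2) := by
    rw [mul_add, add_comm]
    gcongr
    · exact le_max_right _ _
    · exact le_max_left _ _
  refine le_trans ?_ (add_le_add_left hmax _)
  rw [hLam, hL_eq, ← hd₁_eq, ← hd₂_eq]
  have hinner' := mul_le_mul_of_nonneg_left hinner hc
  have hA' := mul_le_mul_of_nonneg_left hA_le hc'
  rw [← hγ_eq] at hA' ⊢
  linear_combination hD_le + hinner' + hA'
end

section
/- Let N > 2 and let w* = (u*,p*) be a saddle point of the Lagrangian L. For all w = (u,p) ∈ U × ℝᵐ and all w' = (u',p') ∈ U × ℝᵐ one has Λ(w,w') ≥ −d₃‖p − p*‖², where d₃ = ε(N−1)²/(2γN(N−2)). -/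
open scoped RealInnerProductSpace

/-- A weighted Young inequality, from completing the square in `a * x - c * γ * y`. -/
theorem sq_completion_nonneg {ε ν γ c : ℝ} (hε : 0 ≤ ε) (hν : 0 < ν) (hγ : 0 < γ) (hc : 0 < c)
    (a x y : ℝ) :
    0 ≤ ε * a ^ 2 / (2 * γ * ν * c) * x ^ 2 + ε * a / ν * -(x * y)
      + ε * c * γ / (2 * ν) * y ^ 2 := by
  have hsq : ε * a ^ 2 / (2 * γ * ν * c) * x ^ 2 + ε * a / ν * -(x * y)
      + ε * c * γ / (2 * ν) * y ^ 2 = ε / (2 * γ * ν * c) * (a * x - c * γ * y) ^ 2 := by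
    field_simp
    ring
  rw [hsq]
  positivity

/-- Problem data for the linearly constrained convex program (P):
`min G(u)+J(u) s.t. Au = b, u ∈ U`, together with the core function `K`,
the algorithm parameters, a saddle point `(ustar, pstar)` of the Lagrangian `L`,
the Bregman-like function `D` and the merit function `Λ`. -/
theorem lambda_dual_lower_bound
    (n m : ℕ)
    (U : Set (EuclideanSpace ℝ (Fin n)))
    (hUclosed : IsClosed U) (hUconvex : Convex ℝ U) (hUne : U.Nonempty)
    (G J : EuclideanSpace ℝ (Fin n) → ℝ)
    (G' : EuclideanSpace ℝ (Fin n) → EuclideanSpace ℝ (Fin n))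
    (BG : ℝ)
    (hGconv : ConvexOn ℝ U G)
    (hGdiff : ∀ x, HasGradientAt G (G' x) x)
    (hGLip : ∀ x ∈ U, ∀ y ∈ U, ‖G' x - G' y‖ ≤ BG * ‖x - y‖)
    (hJconv : ConvexOn ℝ U J)
    (hJlsc : LowerSemicontinuous J)
    (A : EuclideanSpace ℝ (Fin n) →L[ℝ] EuclideanSpace ℝ (Fin m))
    (b : EuclideanSpace ℝ (Fin m))
    -- `lam` is the largest eigenvalue of `AᵀA`, i.e. the square of the operator norm of `A`
    (lam : ℝ) (hlam : lam = ‖A‖ ^ 2)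
    (K : EuclideanSpace ℝ (Fin n) → ℝ)
    (K' : EuclideanSpace ℝ (Fin n) → EuclideanSpace ℝ (Fin n))
    (β B : ℝ) (hβ : 0 < β)
    (hKdiff : ∀ x, HasGradientAt K (K' x) x)
    -- strong convexity of `K` with parameter `β` (on `U`)
    (hKstrong : ∀ x ∈ U, ∀ y ∈ U, K x + ⟪K' x, y - x⟫ + β / 2 * ‖y - x‖ ^ 2 ≤ K y)
    -- Lipschitz continuity of `∇K` with constant `B` (on `U`)
    (hKLip : ∀ x ∈ U, ∀ y ∈ U, ‖K' x - K' y‖ ≤ B * ‖x - y‖)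
    (N : ℕ) (hN : 2 ≤ N)
    (γ ε ρ : ℝ) (hγ : 0 < γ)
    (hε : 0 < ε ∧ ε < β / (BG + γ * lam))
    (hρ : 0 < ρ ∧ ρ < 2 * γ / (2 * (N : ℝ) - 1))
    -- the Lagrangian
    (L : EuclideanSpace ℝ (Fin n) → EuclideanSpace ℝ (Fin m) → ℝ)
    (hL : ∀ u p, L u p = G u + J u + ⟪p, A u - b⟫)
    -- the Bregman-like function
    (D : EuclideanSpace ℝ (Fin n) → EuclideanSpace ℝ (Fin n) → ℝ)
    (hD : ∀ x y, D x y = K x - K y - ⟪K' y, x - y⟫)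
    -- a saddle point of `L` on `U × ℝᵐ`
    (ustar : EuclideanSpace ℝ (Fin n)) (pstar : EuclideanSpace ℝ (Fin m))
    (hustar : ustar ∈ U)
    (hsaddle : ∀ u ∈ U, ∀ p : EuclideanSpace ℝ (Fin m),
      L ustar p ≤ L ustar pstar ∧ L ustar pstar ≤ L u pstar)
    -- the function `Λ`
    (Lam : (EuclideanSpace ℝ (Fin n) × EuclideanSpace ℝ (Fin m)) →
      (EuclideanSpace ℝ (Fin n) × EuclideanSpace ℝ (Fin m)) → ℝ)
    (hLam : ∀ w w', Lam w w' = D w'.1 w.1 + ε / (2 * (N : ℝ) * ρ) * ‖w.2 - w'.2‖ ^ 2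
      + ε * ((N : ℝ) - 1) / (N : ℝ) * (L w.1 w.2 - L ustar pstar)
      + ε * ((N : ℝ) - 2) * γ / (2 * (N : ℝ)) * ‖A w.1 - b‖ ^ 2)
    (hN2 : 2 < N)
    : ∀ u ∈ U, ∀ p : EuclideanSpace ℝ (Fin m), ∀ u' ∈ U, ∀ p' : EuclideanSpace ℝ (Fin m),
        -(ε * ((N : ℝ) - 1) ^ 2 / (2 * γ * (N : ℝ) * ((N : ℝ) - 2))) * ‖p - pstar‖ ^ 2 ≤
          Lam (u, p) (u', p') := by
  intro u hu p u' hu' p'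
  have hN' : (2 : ℝ) < N := by exact_mod_cast hN2
  have hN0 : (0 : ℝ) < N := by linarith
  have hNsub : (0 : ℝ) < (N : ℝ) - 2 := by linarith
  obtain ⟨hε0, -⟩ := hε
  obtain ⟨hρ0, -⟩ := hρ
  have hDnonneg : 0 ≤ D u' u := by
    rw [hD]
    have := hKstrong u hu u' hu'
    have : 0 ≤ β / 2 * ‖u' - u‖ ^ 2 := by positivity
    linarith
  have hdual : 0 ≤ ε / (2 * (N : ℝ) * ρ) * ‖p - p'‖ ^ 2 := by positivity
  have hgap : -(‖p - pstar‖ * ‖A u - b‖) ≤ L u p - L ustar pstar := by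
    have hsad := (hsaddle u hu p).2
    have hsplit : L u p - L u pstar = ⟪p - pstar, A u - b⟫ := by
      rw [hL, hL, inner_sub_left]
      ring
    have hcs := neg_le_of_abs_le (abs_real_inner_le_norm (p - pstar) (A u - b))
    linarith
  have hcoef : 0 ≤ ε * ((N : ℝ) - 1) / (N : ℝ) :=
    div_nonneg (mul_nonneg hε0.le (by linarith)) hN0.le
  have hgap_scaled := mul_le_mul_of_nonneg_left hgap hcoef
  have hsquare := sq_completion_nonneg hε0.le hN0 hγ hNsub ((N : ℝ) - 1)
    ‖p - pstar‖ ‖A u - b‖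
  rw [hLam]
  dsimp only
  linarith
end

section
/- Let w* = (u*,p*) be a saddle point of the Lagrangian L and define φ(w,w*) = Λ(w,w*) + (ε/N)[L(u,p*) − L(u*,p*)] for w = (u,p) ∈ U × ℝᵐ. Then φ(w,w*) ≥ d₁‖w − w*‖², where d₁ = min{ (Nβ − εγλ_max(AᵀA))/(2N), ε/(4Nγ) }. -/
open scoped RealInnerProductSpace

/-- Young's inequality `-2⟪q, r⟫ ≤ ‖q‖² / γ + γ ‖r‖²`, cleared of its denominator. -/
theorem norm_sq_add_two_mul_inner_add_norm_sq_nonneg {E : Type*}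
    [NormedAddCommGroup E] [InnerProductSpace ℝ E]
    (γ : ℝ) (q r : E) :
    0 ≤ ‖q‖ ^ 2 + 2 * γ * ⟪q, r⟫ + γ ^ 2 * ‖r‖ ^ 2 := by
  have h := norm_add_sq_real q (γ • r)
  rw [inner_smul_right, norm_smul, mul_pow, Real.norm_eq_abs, sq_abs] at h
  nlinarith [sq_nonneg ‖q + γ • r‖]

/-- Problem data for the linearly constrained convex program (P):
`min G(u)+J(u) s.t. Au = b, u ∈ U`, together with the core function `K`,
the algorithm parameters, a saddle point `(ustar, pstar)` of the Lagrangian `L`,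
the Bregman-like function `D` and the merit function `Λ`. -/
theorem phi_lower_bound
    (n m : ℕ)
    (U : Set (EuclideanSpace ℝ (Fin n)))
    (hUclosed : IsClosed U) (hUconvex : Convex ℝ U) (hUne : U.Nonempty)
    (G J : EuclideanSpace ℝ (Fin n) → ℝ)
    (G' : EuclideanSpace ℝ (Fin n) → EuclideanSpace ℝ (Fin n))
    (BG : ℝ)
    (hGconv : ConvexOn ℝ U G)
    (hGdiff : ∀ x, HasGradientAt G (G' x) x)
    (hGLip : ∀ x ∈ U, ∀ y ∈ U, ‖G' x - G' y‖ ≤ BG * ‖x - y‖)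
    (hJconv : ConvexOn ℝ U J)
    (hJlsc : LowerSemicontinuous J)
    (A : EuclideanSpace ℝ (Fin n) →L[ℝ] EuclideanSpace ℝ (Fin m))
    (b : EuclideanSpace ℝ (Fin m))
    -- `lam` is the largest eigenvalue of `AᵀA`, i.e. the square of the operator norm of `A`
    (lam : ℝ) (hlam : lam = ‖A‖ ^ 2)
    (K : EuclideanSpace ℝ (Fin n) → ℝ)
    (K' : EuclideanSpace ℝ (Fin n) → EuclideanSpace ℝ (Fin n))
    (β B : ℝ) (hβ : 0 < β)
    (hKdiff : ∀ x, HasGradientAt K (K' x) x)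
    -- strong convexity of `K` with parameter `β` (on `U`)
    (hKstrong : ∀ x ∈ U, ∀ y ∈ U, K x + ⟪K' x, y - x⟫ + β / 2 * ‖y - x‖ ^ 2 ≤ K y)
    -- Lipschitz continuity of `∇K` with constant `B` (on `U`)
    (hKLip : ∀ x ∈ U, ∀ y ∈ U, ‖K' x - K' y‖ ≤ B * ‖x - y‖)
    (N : ℕ) (hN : 2 ≤ N)
    (γ ε ρ : ℝ) (hγ : 0 < γ)
    (hε : 0 < ε ∧ ε < β / (BG + γ * lam))
    (hρ : 0 < ρ ∧ ρ < 2 * γ / (2 * (N : ℝ) - 1))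
    -- the Lagrangian
    (L : EuclideanSpace ℝ (Fin n) → EuclideanSpace ℝ (Fin m) → ℝ)
    (hL : ∀ u p, L u p = G u + J u + ⟪p, A u - b⟫)
    -- the Bregman-like function
    (D : EuclideanSpace ℝ (Fin n) → EuclideanSpace ℝ (Fin n) → ℝ)
    (hD : ∀ x y, D x y = K x - K y - ⟪K' y, x - y⟫)
    -- a saddle point of `L` on `U × ℝᵐ`
    (ustar : EuclideanSpace ℝ (Fin n)) (pstar : EuclideanSpace ℝ (Fin m))
    (hustar : ustar ∈ U)
    (hsaddle : ∀ u ∈ U, ∀ p : EuclideanSpace ℝ (Fin m),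
      L ustar p ≤ L ustar pstar ∧ L ustar pstar ≤ L u pstar)
    -- the function `Λ`
    (Lam : (EuclideanSpace ℝ (Fin n) × EuclideanSpace ℝ (Fin m)) →
      (EuclideanSpace ℝ (Fin n) × EuclideanSpace ℝ (Fin m)) → ℝ)
    (hLam : ∀ w w', Lam w w' = D w'.1 w.1 + ε / (2 * (N : ℝ) * ρ) * ‖w.2 - w'.2‖ ^ 2
      + ε * ((N : ℝ) - 1) / (N : ℝ) * (L w.1 w.2 - L ustar pstar)
      + ε * ((N : ℝ) - 2) * γ / (2 * (N : ℝ)) * ‖A w.1 - b‖ ^ 2)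
    -- the function `φ(·, w*)`
    (phi : (EuclideanSpace ℝ (Fin n) × EuclideanSpace ℝ (Fin m)) → ℝ)
    (hphi : ∀ w, phi w = Lam w (ustar, pstar) + ε / (N : ℝ) * (L w.1 pstar - L ustar pstar))
    : ∀ u ∈ U, ∀ p : EuclideanSpace ℝ (Fin m),
        min (((N : ℝ) * β - ε * γ * lam) / (2 * (N : ℝ))) (ε / (4 * (N : ℝ) * γ)) *
            (‖u - ustar‖ ^ 2 + ‖p - pstar‖ ^ 2) ≤ phi (u, p) := by
  intro u hu p
  obtain ⟨hε0, -⟩ := hε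
  obtain ⟨hρ0, hρ1⟩ := hρ
  have hN2 : (2 : ℝ) ≤ N := by exact_mod_cast hN
  have hN0 : (0 : ℝ) < N := by linarith
  have hfeas : A ustar - b = 0 := by
    have h := (hsaddle ustar hustar (pstar + (A ustar - b))).1
    rw [hL, hL, inner_add_left, real_inner_self_eq_norm_sq] at h
    have h0 : ‖A ustar - b‖ ^ 2 = 0 := le_antisymm (by linarith) (sq_nonneg _)
    exact norm_eq_zero.mp (pow_eq_zero_iff two_ne_zero |>.mp h0)
  have hres : ‖A u - b‖ ^ 2 ≤ lam * ‖u - ustar‖ ^ 2 := by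
    have h : A u - b = A (u - ustar) := by
      rw [map_sub, sub_eq_zero.mp hfeas]
    rw [h, hlam, ← mul_pow]
    exact pow_le_pow_left₀ (norm_nonneg _) (A.le_opNorm _) 2
  have hbreg : β / 2 * ‖u - ustar‖ ^ 2 ≤ D ustar u := by
    have h := hKstrong u hu ustar hustar
    rw [hD, norm_sub_rev u ustar]
    linarith
  have hLsplit : L u p = L u pstar + ⟪p - pstar, A u - b⟫ := by
    rw [hL, hL, inner_sub_left]
    ring
  have hgap := (hsaddle u hu p).2
  have hyoung := norm_sq_add_two_mul_inner_add_norm_sq_nonneg γ (p - pstar) (A u - b)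
  have hinv : (2 * (N : ℝ) - 1) / (2 * γ) ≤ 1 / ρ := by
    rw [lt_div_iff₀ (by linarith)] at hρ1
    rw [div_le_div_iff₀ (by positivity) hρ0]
    linarith
  rw [hphi, hLam]
  dsimp only
  rw [hLsplit]
  generalize ‖A u - b‖ ^ 2 = R at *
  generalize hX : ‖u - ustar‖ ^ 2 = X at *
  generalize hQ : ‖p - pstar‖ ^ 2 = Q at *
  generalize ⟪p - pstar, A u - b⟫ = S at *
  have hQ0 : 0 ≤ Q := hQ ▸ sq_nonneg _
  have hX0 : 0 ≤ X := hX ▸ sq_nonneg _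
  have hdual : ε / (2 * N) * ((2 * (N : ℝ) - 1) / (2 * γ)) * Q ≤ ε / (2 * N * ρ) * Q := by
    have h : ε / (2 * N * ρ) = ε / (2 * N) * (1 / ρ) := by field_simp
    rw [h]
    gcongr
  have hmin : min ((N * β - ε * γ * lam) / (2 * N)) (ε / (4 * N * γ)) * (X + Q) ≤
      (N * β - ε * γ * lam) / (2 * N) * X + ε / (4 * N * γ) * Q := by
    rw [mul_add]
    gcongr
    · exact min_le_left _ _
    · exact min_le_right _ _
  have hgap' : 0 ≤ ε * (L u pstar - L ustar pstar) := mul_nonneg hε0.le (by linarith)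
  have hyoung' : 0 ≤ ε * (N - 1) / (2 * N * γ) * (Q + 2 * γ * S + γ ^ 2 * R) :=
    mul_nonneg (div_nonneg (mul_nonneg hε0.le (by linarith)) (by positivity)) hyoung
  have hres' : ε * γ / (2 * N) * R ≤ ε * γ / (2 * N) * (lam * X) := by gcongr
  have hsum : D ustar u + ε / (2 * N * ρ) * Q
        + ε * (N - 1) / N * (L u pstar + S - L ustar pstar)
        + ε * (N - 2) * γ / (2 * N) * R + ε / N * (L u pstar - L ustar pstar)
      = ((N * β - ε * γ * lam) / (2 * N) * X + ε / (4 * N * γ) * Q)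
        + (D ustar u - β / 2 * X)
        + (ε / (2 * N * ρ) * Q - ε / (2 * N) * ((2 * N - 1) / (2 * γ)) * Q)
        + ε * (L u pstar - L ustar pstar)
        + ε * (N - 1) / (2 * N * γ) * (Q + 2 * γ * S + γ ^ 2 * R)
        + (ε * γ / (2 * N) * (lam * X) - ε * γ / (2 * N) * R) := by
    field_simp
    ring
  linarith
end

section
/- Let w* = (u*,p*) be a saddle point of the Lagrangian L and define φ(w,w*) = Λ(w,w*) + (ε/N)[L(u,p*) − L(u*,p*)] for w = (u,p) ∈ U × ℝᵐ. Then φ(w,w*) ≤ d₂‖w − w*‖² + ε[L(u,p*) − L(u*,p*)], where d₂ = max{ (4N−3)ε/((4N−2)Nρ), (NB + ε(2N−3)γλ_max(AᵀA))/(2N) }. -/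
open scoped RealInnerProductSpace

/-- Descent lemma on a convex set: a function whose gradient is `B`-Lipschitz on `U` lies below
its quadratic upper model. -/
theorem bregman_le_of_lipschitz_gradient {E : Type*} [NormedAddCommGroup E]
    [InnerProductSpace ℝ E] [CompleteSpace E] {U : Set E} (hU : Convex ℝ U) {K : E → ℝ}
    {K' : E → E} {B : ℝ} (hK : ∀ x ∈ U, HasGradientAt K (K' x) x)
    (hLip : ∀ x ∈ U, ∀ y ∈ U, ‖K' x - K' y‖ ≤ B * ‖x - y‖) {x y : E} (hx : x ∈ U) (hy : y ∈ U) :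
    K y - K x - ⟪K' x, y - x⟫ ≤ B / 2 * ‖y - x‖ ^ 2 := by
  set d := y - x with hd
  have hmem : ∀ t ∈ Set.Icc (0 : ℝ) 1, x + t • d ∈ U := fun t ht =>
    hU.add_smul_sub_mem hx hy ht
  let h : ℝ → ℝ := fun t => K (x + t • d) - t * ⟪K' x, d⟫ - B / 2 * ‖d‖ ^ 2 * t ^ 2
  have hderiv : ∀ t ∈ Set.Icc (0 : ℝ) 1,
      HasDerivAt h (⟪K' (x + t • d), d⟫ - ⟪K' x, d⟫ - B * t * ‖d‖ ^ 2) t := by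
    intro t ht
    have hline : HasDerivAt (fun s : ℝ => x + s • d) d t := by
      simpa using ((hasDerivAt_id t).smul_const d).const_add x
    have hcomp := (hK _ (hmem t ht)).hasFDerivAt.comp_hasDerivAt t hline
    have hlin := (hasDerivAt_id t).mul_const ⟪K' x, d⟫
    have hquad := (hasDerivAt_pow 2 t).const_mul (B / 2 * ‖d‖ ^ 2)
    refine ((hcomp.sub hlin).sub hquad).congr_deriv ?_
    simp only [InnerProductSpace.toDual_apply_apply]
    norm_num
    ring
  have hanti : AntitoneOn h (Set.Icc 0 1) := by
    refine antitoneOn_of_deriv_nonpos (convex_Icc 0 1)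
      (fun t ht => (hderiv t ht).continuousAt.continuousWithinAt)
      (fun t ht => (hderiv t (interior_subset ht)).differentiableAt.differentiableWithinAt) ?_
    intro t ht
    have ht' := interior_subset ht
    rw [(hderiv t ht').deriv, ← inner_sub_left]
    have hcs := real_inner_le_norm (K' (x + t • d) - K' x) d
    have hl := hLip _ (hmem t ht') x hx
    rw [add_sub_cancel_left, norm_smul, Real.norm_of_nonneg ht'.1] at hl
    nlinarith [mul_le_mul_of_nonneg_right hl (norm_nonneg d)]
  have h01 := hanti (Set.left_mem_Icc.2 zero_le_one) (Set.right_mem_Icc.2 zero_le_one) zero_le_one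
  simp only [h, zero_smul, one_smul, add_zero, hd, add_sub_cancel] at h01
  linarith

/-- Weighted Young inequality for the inner product. -/
theorem real_inner_le_weighted_norm_sq {E : Type*} [NormedAddCommGroup E]
    [InnerProductSpace ℝ E] (x y : E) {c : ℝ} (hc : 0 < c) :
    ⟪x, y⟫ ≤ ‖x‖ ^ 2 / c + c / 4 * ‖y‖ ^ 2 := by
  refine (real_inner_le_norm x y).trans ?_
  have h : ‖x‖ ^ 2 / c + c / 4 * ‖y‖ ^ 2 - ‖x‖ * ‖y‖ = (‖x‖ - c / 2 * ‖y‖) ^ 2 / c := by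
    field_simp
    ring
  have : 0 ≤ (‖x‖ - c / 2 * ‖y‖) ^ 2 / c := by positivity
  linarith

/-- Problem data for the linearly constrained convex program (P):
`min G(u)+J(u) s.t. Au = b, u ∈ U`, together with the core function `K`,
the algorithm parameters, a saddle point `(ustar, pstar)` of the Lagrangian `L`,
the Bregman-like function `D` and the merit function `Λ`. -/
theorem phi_upper_bound
    (n m : ℕ)
    (U : Set (EuclideanSpace ℝ (Fin n)))
    (hUclosed : IsClosed U) (hUconvex : Convex ℝ U) (hUne : U.Nonempty)
    (G J : EuclideanSpace ℝ (Fin n) → ℝ)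
    (G' : EuclideanSpace ℝ (Fin n) → EuclideanSpace ℝ (Fin n))
    (BG : ℝ)
    (hGconv : ConvexOn ℝ U G)
    (hGdiff : ∀ x, HasGradientAt G (G' x) x)
    (hGLip : ∀ x ∈ U, ∀ y ∈ U, ‖G' x - G' y‖ ≤ BG * ‖x - y‖)
    (hJconv : ConvexOn ℝ U J)
    (hJlsc : LowerSemicontinuous J)
    (A : EuclideanSpace ℝ (Fin n) →L[ℝ] EuclideanSpace ℝ (Fin m))
    (b : EuclideanSpace ℝ (Fin m))
    -- `lam` is the largest eigenvalue of `AᵀA`, i.e. the square of the operator norm of `A`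
    (lam : ℝ) (hlam : lam = ‖A‖ ^ 2)
    (K : EuclideanSpace ℝ (Fin n) → ℝ)
    (K' : EuclideanSpace ℝ (Fin n) → EuclideanSpace ℝ (Fin n))
    (β B : ℝ) (hβ : 0 < β)
    (hKdiff : ∀ x, HasGradientAt K (K' x) x)
    -- strong convexity of `K` with parameter `β` (on `U`)
    (hKstrong : ∀ x ∈ U, ∀ y ∈ U, K x + ⟪K' x, y - x⟫ + β / 2 * ‖y - x‖ ^ 2 ≤ K y)
    -- Lipschitz continuity of `∇K` with constant `B` (on `U`)
    (hKLip : ∀ x ∈ U, ∀ y ∈ U, ‖K' x - K' y‖ ≤ B * ‖x - y‖)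
    (N : ℕ) (hN : 2 ≤ N)
    (γ ε ρ : ℝ) (hγ : 0 < γ)
    (hε : 0 < ε ∧ ε < β / (BG + γ * lam))
    (hρ : 0 < ρ ∧ ρ < 2 * γ / (2 * (N : ℝ) - 1))
    -- the Lagrangian
    (L : EuclideanSpace ℝ (Fin n) → EuclideanSpace ℝ (Fin m) → ℝ)
    (hL : ∀ u p, L u p = G u + J u + ⟪p, A u - b⟫)
    -- the Bregman-like function
    (D : EuclideanSpace ℝ (Fin n) → EuclideanSpace ℝ (Fin n) → ℝ)
    (hD : ∀ x y, D x y = K x - K y - ⟪K' y, x - y⟫)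
    -- a saddle point of `L` on `U × ℝᵐ`
    (ustar : EuclideanSpace ℝ (Fin n)) (pstar : EuclideanSpace ℝ (Fin m))
    (hustar : ustar ∈ U)
    (hsaddle : ∀ u ∈ U, ∀ p : EuclideanSpace ℝ (Fin m),
      L ustar p ≤ L ustar pstar ∧ L ustar pstar ≤ L u pstar)
    -- the function `Λ`
    (Lam : (EuclideanSpace ℝ (Fin n) × EuclideanSpace ℝ (Fin m)) →
      (EuclideanSpace ℝ (Fin n) × EuclideanSpace ℝ (Fin m)) → ℝ)
    (hLam : ∀ w w', Lam w w' = D w'.1 w.1 + ε / (2 * (N : ℝ) * ρ) * ‖w.2 - w'.2‖ ^ 2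
      + ε * ((N : ℝ) - 1) / (N : ℝ) * (L w.1 w.2 - L ustar pstar)
      + ε * ((N : ℝ) - 2) * γ / (2 * (N : ℝ)) * ‖A w.1 - b‖ ^ 2)
    -- the function `φ(·, w*)`
    (phi : (EuclideanSpace ℝ (Fin n) × EuclideanSpace ℝ (Fin m)) → ℝ)
    (hphi : ∀ w, phi w = Lam w (ustar, pstar) + ε / (N : ℝ) * (L w.1 pstar - L ustar pstar))
    : ∀ u ∈ U, ∀ p : EuclideanSpace ℝ (Fin m),
        phi (u, p) ≤
          max ((4 * (N : ℝ) - 3) * ε / ((4 * (N : ℝ) - 2) * (N : ℝ) * ρ))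
              (((N : ℝ) * B + ε * (2 * (N : ℝ) - 3) * γ * lam) / (2 * (N : ℝ))) *
            (‖u - ustar‖ ^ 2 + ‖p - pstar‖ ^ 2)
          + ε * (L u pstar - L ustar pstar) := by
  intro u hu p
  have hN2 : (2 : ℝ) ≤ N := by exact_mod_cast hN
  have hN0 : (0 : ℝ) < N := by linarith
  obtain ⟨hε0, -⟩ := hε
  obtain ⟨hρ0, hργ⟩ := hρ
  have hfeas : A ustar = b := by
    have h := (hsaddle ustar hustar (pstar + (A ustar - b))).1
    rw [hL, hL, inner_add_left, real_inner_self_eq_norm_sq] at h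
    have h0 : ‖A ustar - b‖ ^ 2 = 0 := le_antisymm (by linarith) (sq_nonneg _)
    exact sub_eq_zero.1 (norm_eq_zero.1 (pow_eq_zero_iff two_ne_zero |>.1 h0))
  have hres : ‖A u - b‖ ^ 2 ≤ lam * ‖u - ustar‖ ^ 2 := by
    rw [← hfeas, ← map_sub, hlam, ← mul_pow]
    gcongr
    exact A.le_opNorm _
  have hbreg : D ustar u ≤ B / 2 * ‖u - ustar‖ ^ 2 := by
    rw [hD, norm_sub_rev u]
    exact bregman_le_of_lipschitz_gradient hUconvex (fun x _ => hKdiff x) hKLip hu hustar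
  have hLp : L u p = L u pstar + ⟪p - pstar, A u - b⟫ := by
    rw [hL, hL, inner_sub_left]
    ring
  have hc : 0 < (2 * (N : ℝ) - 1) * ρ := mul_pos (by linarith) hρ0
  have hcγ : (2 * (N : ℝ) - 1) * ρ / 4 ≤ γ / 2 := by
    rw [lt_div_iff₀ (by linarith)] at hργ
    linarith
  have hcross : ⟪p - pstar, A u - b⟫ ≤
      ‖p - pstar‖ ^ 2 / ((2 * (N : ℝ) - 1) * ρ) + γ / 2 * ‖A u - b‖ ^ 2 :=
    (real_inner_le_weighted_norm_sq _ _ hc).trans (by gcongr)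
  have hcoef : 0 ≤ ε * ((N : ℝ) - 1) / N :=
    div_nonneg (mul_nonneg hε0.le (by linarith)) hN0.le
  have hcoefres : 0 ≤ ε * (2 * (N : ℝ) - 3) * γ / (2 * N) :=
    div_nonneg (mul_nonneg (mul_nonneg hε0.le (by linarith)) hγ.le) (by linarith)
  rw [hphi, hLam]
  simp only
  rw [hLp]
  set d₁ := (4 * (N : ℝ) - 3) * ε / ((4 * (N : ℝ) - 2) * (N : ℝ) * ρ) with hd₁
  set d₂ := ((N : ℝ) * B + ε * (2 * (N : ℝ) - 3) * γ * lam) / (2 * (N : ℝ)) with hd₂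
  have hmax₁ : d₁ * ‖p - pstar‖ ^ 2 ≤ max d₁ d₂ * ‖p - pstar‖ ^ 2 := by
    gcongr
    exact le_max_left _ _
  have hmax₂ : d₂ * ‖u - ustar‖ ^ 2 ≤ max d₁ d₂ * ‖u - ustar‖ ^ 2 := by
    gcongr
    exact le_max_right _ _
  have hd₁_eq : d₁ * ‖p - pstar‖ ^ 2 = ε / (2 * (N : ℝ) * ρ) * ‖p - pstar‖ ^ 2
      + ε * ((N : ℝ) - 1) / N * (‖p - pstar‖ ^ 2 / ((2 * (N : ℝ) - 1) * ρ)) := by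
    obtain ⟨c, hc_eq⟩ : ∃ c : ℝ, c = 2 * (N : ℝ) - 1 := ⟨_, rfl⟩
    have hc0 : c ≠ 0 := by linarith
    rw [hd₁, show 4 * (N : ℝ) - 2 = 2 * c by linarith, ← hc_eq]
    field_simp
    rw [hc_eq]
    ring
  have hd₂_eq : d₂ * ‖u - ustar‖ ^ 2 = B / 2 * ‖u - ustar‖ ^ 2
      + ε * (2 * (N : ℝ) - 3) * γ / (2 * N) * (lam * ‖u - ustar‖ ^ 2) := by
    rw [hd₂]
    field_simp
  have hγ_eq : ε * ((N : ℝ) - 1) / N * (γ / 2 * ‖A u - b‖ ^ 2)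
      + ε * ((N : ℝ) - 2) * γ / (2 * N) * ‖A u - b‖ ^ 2
      = ε * (2 * (N : ℝ) - 3) * γ / (2 * N) * ‖A u - b‖ ^ 2 := by
    field_simp
    ring
  have hε_eq : ε * ((N : ℝ) - 1) / N * (L u pstar - L ustar pstar)
      + ε / N * (L u pstar - L ustar pstar) = ε * (L u pstar - L ustar pstar) := by
    field_simp
    ring
  have hcross' := mul_le_mul_of_nonneg_left hcross hcoef
  have hres' := mul_le_mul_of_nonneg_left hres hcoefres
  linarith
end

section
/- Consider the machine learning portfolio problem: minimize (1/2)uᵀΣu + λ‖u‖₁ over u ∈ ℝⁿ subject to μᵀu = ρ and 𝟏ₙᵀu = 1, with Σ ∈ ℝ^{n×n} symmetric positive definite, λ ≥ 0, μ ∈ ℝⁿ, and let (u*, p₁*, p₂*) be a KKT point. If there exist indices i ≠ j with u*ᵢ ≠ 0, u*ⱼ ≠ 0 and μᵢ ≠ μⱼ, then the KKT mapping H(u, p₁, p₂) = (Σu + λ∂‖u‖₁ + p₁·𝟏ₙ + p₂·μ, μᵀu − ρ, 𝟏ₙᵀu − 1) is globally strongly metrically subregular at (u*, p₁*, p₂*)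 for 0, i.e. there exists 𝔠 > 0 such that ‖(u,p₁,p₂) − (u*,p₁*,p₂*)‖ ≤ 𝔠 · dist(0, H(u,p₁,p₂)) for all (u,p₁,p₂). -/
open Finset Matrix

/-- A positive definite real quadratic form is coercive with respect to the Euclidean norm. -/
lemma Matrix.PosDef.exists_pos_mul_sum_sq_le {n : ℕ} {A : Matrix (Fin n) (Fin n) ℝ}
    (hA : A.PosDef) :
    ∃ m : ℝ, 0 < m ∧ ∀ x : Fin n → ℝ, m * ∑ k, x k ^ 2 ≤ ∑ k, x k * (A *ᵥ x) k := by
  let q : EuclideanSpace ℝ (Fin n) → ℝ := fun x ↦ x.ofLp ⬝ᵥ (A *ᵥ x.ofLp)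
  have hq : Continuous q := by
    have hc : Continuous fun x : EuclideanSpace ℝ (Fin n) ↦ x.ofLp := by fun_prop
    exact hc.dotProduct (continuous_const.matrix_mulVec hc)
  have hpos : ∀ x : EuclideanSpace ℝ (Fin n), x ≠ 0 → 0 < q x := fun x hx ↦ by
    have hx' : x.ofLp ≠ 0 := fun h ↦ hx (by ext k; simp [h])
    simpa using hA.dotProduct_mulVec_pos hx'
  obtain ⟨m, hm, hmin⟩ : ∃ m : ℝ, 0 < m ∧ ∀ x : EuclideanSpace ℝ (Fin n), ‖x‖ = 1 → m ≤ q x := by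
    rcases (Metric.sphere (0 : EuclideanSpace ℝ (Fin n)) 1).eq_empty_or_nonempty with he | hne
    · exact ⟨1, one_pos, fun x hx ↦ absurd (by simpa using hx)
        (Set.eq_empty_iff_forall_notMem.mp he x)⟩
    · obtain ⟨x₀, hx₀, hx₀min⟩ := (isCompact_sphere _ _).exists_isMinOn hne hq.continuousOn
      refine ⟨q x₀, hpos x₀ ?_, fun x hx ↦ hx₀min (by simpa using hx)⟩
      rintro rfl
      simp at hx₀
  refine ⟨m, hm, fun x ↦ ?_⟩
  rcases eq_or_ne x 0 with rfl | hx
  · simp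
  have hy : (WithLp.toLp 2 x : EuclideanSpace ℝ (Fin n)) ≠ 0 := by simpa using hx
  set y : EuclideanSpace ℝ (Fin n) := WithLp.toLp 2 x
  have hn : 0 < ‖y‖ := norm_pos_iff.mpr hy
  have h := hmin (‖y‖⁻¹ • y) (by rw [norm_smul, norm_inv, norm_norm, inv_mul_cancel₀ hn.ne'])
  have hscale : q (‖y‖⁻¹ • y) = q y / ‖y‖ ^ 2 := by
    simp only [q, WithLp.ofLp_smul, mulVec_smul, smul_dotProduct, dotProduct_smul, smul_eq_mul]
    field_simp
  rw [hscale, le_div_iff₀ (by positivity), EuclideanSpace.real_norm_sq_eq] at h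
  exact h

lemma abs_le_sqrt_sum_sq {n : ℕ} (x : Fin n → ℝ) (i : Fin n) : |x i| ≤ √(∑ k, x k ^ 2) :=
  Real.abs_le_sqrt (single_le_sum (f := fun k ↦ x k ^ 2) (fun _ _ ↦ sq_nonneg _) (mem_univ i))

lemma abs_sum_mul_le_sqrt_mul_sqrt {n : ℕ} (x y : Fin n → ℝ) :
    |∑ k, x k * y k| ≤ √(∑ k, x k ^ 2) * √(∑ k, y k ^ 2) := by
  rw [← Real.sqrt_mul (sum_nonneg fun _ _ ↦ sq_nonneg _)]
  exact Real.abs_le_sqrt (sum_mul_sq_le_sq_mul_sq _ _ _)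

/-- `s` is a subgradient of the absolute value at `a`. -/
def IsAbsSubgradient (a s : ℝ) : Prop :=
  (a ≠ 0 → s = Real.sign a) ∧ (a = 0 → s ∈ Set.Icc (-1 : ℝ) 1)

namespace IsAbsSubgradient

variable {a b s t : ℝ}

lemma mem_Icc (h : IsAbsSubgradient a s) : s ∈ Set.Icc (-1 : ℝ) 1 := by
  by_cases ha : a = 0
  · exact h.2 ha
  · rw [h.1 ha]
    rcases Real.sign_apply_eq_of_ne_zero a ha with h' | h' <;> rw [h'] <;> simp

lemma eq_one (h : IsAbsSubgradient a s) (ha : 0 < a) : s = 1 := by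
  rw [h.1 ha.ne', Real.sign_of_pos ha]

lemma eq_neg_one (h : IsAbsSubgradient a s) (ha : a < 0) : s = -1 := by
  rw [h.1 ha.ne, Real.sign_of_neg ha]

lemma mul_eq_abs (h : IsAbsSubgradient a s) : a * s = |a| := by
  rcases lt_trichotomy a 0 with ha | rfl | ha
  · rw [h.eq_neg_one ha, abs_of_neg ha]; ring
  · simp
  · rw [h.eq_one ha, abs_of_pos ha]; ring

lemma monotone (ha : IsAbsSubgradient a s) (hb : IsAbsSubgradient b t) :
    0 ≤ (a - b) * (s - t) := by
  have h₁ : a * t ≤ |a| := (le_abs_self _).trans <| by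
    rw [abs_mul]; exact mul_le_of_le_one_right (abs_nonneg _) (abs_le.mpr hb.mem_Icc)
  have h₂ : b * s ≤ |b| := (le_abs_self _).trans <| by
    rw [abs_mul]; exact mul_le_of_le_one_right (abs_nonneg _) (abs_le.mpr ha.mem_Icc)
  linarith [ha.mul_eq_abs, hb.mul_eq_abs, sub_mul a b (s - t), mul_sub a s t, mul_sub b s t]

/-- Away from the kink the subdifferential of the absolute value is calm. -/
lemma abs_sub_le (ha : IsAbsSubgradient a s) (hb : IsAbsSubgradient b t) (hb0 : b ≠ 0) :
    |s - t| ≤ 2 / |b| * |a - b| := by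
  have hpos : 0 < |b| := abs_pos.mpr hb0
  by_cases hst : s = t
  · rw [hst, sub_self, abs_zero]; positivity
  have hdist : |b| ≤ |a - b| := by
    rcases lt_or_gt_of_ne hb0 with hb' | hb'
    · have : 0 ≤ a := not_lt.mp fun h ↦ hst (by rw [ha.eq_neg_one h, hb.eq_neg_one hb'])
      rw [abs_of_neg hb']
      exact le_trans (by linarith) (le_abs_self _)
    · have : a ≤ 0 := not_lt.mp fun h ↦ hst (by rw [ha.eq_one h, hb.eq_one hb'])
      rw [abs_of_pos hb']
      exact le_trans (by linarith) (neg_le_abs _)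
  have hs := ha.mem_Icc
  have ht := hb.mem_Icc
  calc |s - t| ≤ 2 := abs_le.mpr ⟨by linarith [hs.1, ht.2], by linarith [hs.2, ht.1]⟩
    _ = 2 / |b| * |b| := by field_simp
    _ ≤ 2 / |b| * |a - b| := by gcongr

end IsAbsSubgradient

/-- Two affine values at distinct abscissae control the coefficients. -/
lemma exists_abs_add_abs_le_of_ne {x y : ℝ} (hxy : x ≠ y) :
    ∃ C : ℝ, 0 < C ∧ ∀ p q : ℝ, |p| + |q| ≤ C * (|p + q * x| + |p + q * y|) := by
  have hd : 0 < |x - y| := abs_pos.mpr (sub_ne_zero.mpr hxy)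
  refine ⟨1 + (1 + |x|) / |x - y|, by positivity, fun p q ↦ ?_⟩
  have hq : |q| ≤ (|p + q * x| + |p + q * y|) / |x - y| := by
    rw [le_div_iff₀ hd, ← abs_mul]
    calc |q * (x - y)| = |(p + q * x) - (p + q * y)| := by ring_nf
      _ ≤ _ := abs_sub _ _
  have hp : |p| ≤ |p + q * x| + |q| * |x| := by
    calc |p| = |(p + q * x) - q * x| := by ring_nf
      _ ≤ |p + q * x| + |q * x| := abs_sub _ _
      _ = _ := by rw [abs_mul]
  calc |p| + |q| ≤ |p + q * x| + |p + q * y| + (1 + |x|) * |q| := by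
        linarith [abs_nonneg (p + q * y)]
    _ ≤ |p + q * x| + |p + q * y| + (1 + |x|) * ((|p + q * x| + |p + q * y|) / |x - y|) := by
        gcongr
    _ = _ := by ring

lemma le_mul_of_mul_sq_le {m C D R : ℝ} (hm : 0 < m) (hC : 0 < C) (hD : 0 ≤ D) (hR : 0 ≤ R)
    (h : m * D ^ 2 ≤ C * R * (R + D)) : D ≤ (1 + 2 * C / m) * R := by
  have hK : 0 ≤ 2 * C / m * R := by positivity
  rcases le_total D R with hDR | hRD
  · linarith
  rcases hD.eq_or_lt with rfl | hD0
  · positivity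
  have h₂ : m * D ≤ 2 * C * R := by
    refine le_of_mul_le_mul_right ?_ hD0
    have : C * R * (R + D) ≤ C * R * (D + D) := by gcongr
    linarith
  have : D ≤ 2 * C / m * R := by
    rw [div_mul_eq_mul_div, le_div_iff₀ hm]; linarith
  linarith

/-- The residual at a coordinate in the support of the reference point controls the corresponding
multiplier combination. -/
lemma exists_abs_multiplier_le {n : ℕ} (A : Matrix (Fin n) (Fin n) ℝ) {lam : ℝ} (hlam : 0 ≤ lam)
    {v : Fin n → ℝ} {i : Fin n} (hv : v i ≠ 0) :
    ∃ C : ℝ, 0 ≤ C ∧ ∀ (u : Fin n → ℝ) (s t r w : ℝ), IsAbsSubgradient (u i) s →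
      IsAbsSubgradient (v i) t → r = (A *ᵥ (u - v)) i + lam * (s - t) + w →
      |w| ≤ |r| + C * √(∑ k, (u k - v k) ^ 2) := by
  refine ⟨√(∑ k, A i k ^ 2) + lam * (2 / |v i|), by positivity, fun u s t r w hs ht hr ↦ ?_⟩
  have hA : |(A *ᵥ (u - v)) i| ≤ √(∑ k, A i k ^ 2) * √(∑ k, (u k - v k) ^ 2) :=
    abs_sum_mul_le_sqrt_mul_sqrt (A i) (u - v)
  have hst : |lam * (s - t)| ≤ lam * (2 / |v i|) * √(∑ k, (u k - v k) ^ 2) := by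
    rw [abs_mul, abs_of_nonneg hlam, mul_assoc]
    gcongr
    refine (hs.abs_sub_le ht hv).trans ?_
    gcongr
    exact abs_le_sqrt_sum_sq (fun k ↦ u k - v k) i
  calc |w| = |r - (A *ᵥ (u - v)) i - lam * (s - t)| := by rw [hr]; ring_nf
    _ ≤ |r| + |(A *ᵥ (u - v)) i| + |lam * (s - t)| :=
        (abs_sub _ _).trans (by gcongr; exact abs_sub _ _)
    _ ≤ _ := by linarith

/-- Global strong metric subregularity of the KKT mapping of the machine learning
portfolio problem `min (1/2)uᵀΣu + λ‖u‖₁  s.t. μᵀu = ρ, 𝟏ₙᵀu = 1` at a KKT point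
`(ustar, p₁star, p₂star)` for `0`, assuming the optimal solution has two nonzero
components `i ≠ j` with `μ i ≠ μ j`. The KKT mapping is
`H(u,p₁,p₂) = (Σu + λ∂‖u‖₁ + p₁·𝟏ₙ + p₂·μ, μᵀu − ρ, 𝟏ₙᵀu − 1)`, and global strong
metric subregularity `dist(x, x̄) ≤ 𝔠 · dist(0, H(x))` for all `x` is expressed
equivalently as: every element of `H(u,p₁,p₂)` has norm at least
`dist((u,p₁,p₂),(ustar,p₁star,p₂star))/𝔠`. -/
theorem mlp_kkt_strong_metric_subregular
    (n : ℕ)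
    (Sigma : Matrix (Fin n) (Fin n) ℝ) (hSigma : Sigma.PosDef) (hSsymm : Sigma.IsSymm)
    (lambda : ℝ) (hlambda : 0 ≤ lambda)
    (mu : Fin n → ℝ) (ρ : ℝ)
    -- the subdifferential of the `ℓ¹`-norm at `u`
    (SD : (Fin n → ℝ) → Set (Fin n → ℝ))
    (hSD : ∀ u, SD u = {ξ | ∀ k, (u k ≠ 0 → ξ k = Real.sign (u k)) ∧
      (u k = 0 → ξ k ∈ Set.Icc (-1 : ℝ) 1)})
    -- the KKT point
    (ustar : Fin n → ℝ) (p₁star p₂star : ℝ)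
    (hKKT : (∃ ξ ∈ SD ustar, ∀ k,
        Sigma.mulVec ustar k + lambda * ξ k + p₁star + p₂star * mu k = 0) ∧
      ∑ k, mu k * ustar k = ρ ∧ ∑ k, ustar k = 1)
    (i j : Fin n) (hij : i ≠ j)
    (hui : ustar i ≠ 0) (huj : ustar j ≠ 0) (hmu : mu i ≠ mu j)
    : ∃ 𝔠 : ℝ, 0 < 𝔠 ∧ ∀ (u : Fin n → ℝ) (p₁ p₂ : ℝ), ∀ ξ ∈ SD u,
        Real.sqrt ((∑ k, (u k - ustar k) ^ 2) + (p₁ - p₁star) ^ 2 + (p₂ - p₂star) ^ 2) ≤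
          𝔠 * Real.sqrt ((∑ k, (Sigma.mulVec u k + lambda * ξ k + p₁ + p₂ * mu k) ^ 2) +
            ((∑ k, mu k * u k) - ρ) ^ 2 + ((∑ k, u k) - 1) ^ 2) := by
  obtain ⟨⟨ξs, hξs, hstat⟩, hρ, hone⟩ := hKKT
  have hsub : ∀ {u ξ : Fin n → ℝ}, ξ ∈ SD u → ∀ k, IsAbsSubgradient (u k) (ξ k) := by
    intro u ξ hξ
    rw [hSD u] at hξ
    exact hξ
  obtain ⟨m, hm, hcoer⟩ := hSigma.exists_pos_mul_sum_sq_le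
  obtain ⟨Ci, hCi, hi⟩ := exists_abs_multiplier_le Sigma hlambda hui
  obtain ⟨Cj, hCj, hj⟩ := exists_abs_multiplier_le Sigma hlambda huj
  obtain ⟨K, hK, hpq⟩ := exists_abs_add_abs_le_of_ne hmu
  set L := K * (2 + Ci + Cj) with hL
  have hL0 : 0 < L := by positivity
  set M := 1 + 2 * (1 + L) / m
  have hM0 : 0 < M := by positivity
  refine ⟨M + L * (1 + M), by positivity, fun u p₁ p₂ ξ hξ ↦ ?_⟩
  set r : Fin n → ℝ := fun k ↦ Sigma.mulVec u k + lambda * ξ k + p₁ + p₂ * mu k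
  set a := (∑ k, mu k * u k) - ρ with ha
  set b := (∑ k, u k) - 1 with hb
  set R := √((∑ k, r k ^ 2) + a ^ 2 + b ^ 2)
  set D := √(∑ k, (u k - ustar k) ^ 2)
  set q₁ := p₁ - p₁star
  set q₂ := p₂ - p₂star
  have hD0 : 0 ≤ D := Real.sqrt_nonneg _
  have hR0 : 0 ≤ R := Real.sqrt_nonneg _
  have hDsq : D ^ 2 = ∑ k, (u k - ustar k) ^ 2 := Real.sq_sqrt (sum_nonneg fun _ _ ↦ sq_nonneg _)
  have hrsum : 0 ≤ ∑ k, r k ^ 2 := sum_nonneg fun _ _ ↦ sq_nonneg _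
  have hrR : √(∑ k, r k ^ 2) ≤ R := Real.sqrt_le_sqrt (by linarith [sq_nonneg a, sq_nonneg b])
  have haR : |a| ≤ R := Real.abs_le_sqrt (by linarith [sq_nonneg b])
  have hbR : |b| ≤ R := Real.abs_le_sqrt (by linarith [sq_nonneg a])
  have hres : ∀ k, r k = (Sigma *ᵥ (u - ustar)) k + lambda * (ξ k - ξs k) + (q₁ + q₂ * mu k) := by
    intro k
    rw [mulVec_sub, Pi.sub_apply]
    linear_combination hstat k
  have hmult : |q₁| + |q₂| ≤ L * (R + D) := by
    have h₁ := hi u _ _ _ _ (hsub hξ i) (hsub hξs i) (hres i)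
    have h₂ := hj u _ _ _ _ (hsub hξ j) (hsub hξs j) (hres j)
    have h₃ := (abs_le_sqrt_sum_sq r i).trans hrR
    have h₄ := (abs_le_sqrt_sum_sq r j).trans hrR
    calc |q₁| + |q₂| ≤ K * (|q₁ + q₂ * mu i| + |q₁ + q₂ * mu j|) := hpq _ _
      _ ≤ K * ((2 + Ci + Cj) * (R + D)) := by
          gcongr
          linarith [mul_nonneg hCi hR0, mul_nonneg hCj hR0]
      _ = L * (R + D) := by rw [hL]; ring
  have hquad : m * D ^ 2 ≤ (1 + L) * R * (R + D) := by
    have hsum : ∑ k, (u k - ustar k) * r k = ∑ k, (u k - ustar k) * (Sigma *ᵥ (u - ustar)) k +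
        lambda * ∑ k, (u k - ustar k) * (ξ k - ξs k) + q₁ * b + q₂ * a := by
      rw [hb, ha, ← hone, ← hρ, ← sum_sub_distrib, ← sum_sub_distrib, mul_sum, mul_sum, mul_sum,
        ← sum_add_distrib, ← sum_add_distrib, ← sum_add_distrib]
      refine sum_congr rfl fun k _ ↦ ?_
      rw [hres k]
      ring
    have hmono : 0 ≤ lambda * ∑ k, (u k - ustar k) * (ξ k - ξs k) :=
      mul_nonneg hlambda (sum_nonneg fun k _ ↦ (hsub hξ k).monotone (hsub hξs k))
    have hc := hcoer (u - ustar)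
    simp only [Pi.sub_apply] at hc
    rw [← hDsq] at hc
    have hdr : ∑ k, (u k - ustar k) * r k ≤ D * R :=
      (le_abs_self _).trans <| (abs_sum_mul_le_sqrt_mul_sqrt _ _).trans (by gcongr)
    have hq₁b : -(q₁ * b) ≤ |q₁| * R :=
      (neg_le_abs _).trans (by rw [abs_mul]; gcongr)
    have hq₂a : -(q₂ * a) ≤ |q₂| * R :=
      (neg_le_abs _).trans (by rw [abs_mul]; gcongr)
    have hqR : (|q₁| + |q₂|) * R ≤ L * (R + D) * R := by gcongr
    linarith [mul_nonneg hR0 hR0]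
  have hDR : D ≤ M * R := le_mul_of_mul_sq_le hm (by positivity) hD0 hR0 hquad
  calc √((∑ k, (u k - ustar k) ^ 2) + q₁ ^ 2 + q₂ ^ 2) ≤ D + (|q₁| + |q₂|) := by
        rw [← hDsq]
        refine Real.sqrt_le_iff.mpr ⟨by positivity, ?_⟩
        rw [← sq_abs q₁, ← sq_abs q₂]
        have h₁ := abs_nonneg q₁
        have h₂ := abs_nonneg q₂
        linarith [mul_nonneg hD0 h₁, mul_nonneg hD0 h₂, mul_nonneg h₁ h₂]
    _ ≤ M * R + L * (R + M * R) := by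
        refine add_le_add hDR (hmult.trans ?_)
        gcongr
    _ = (M + L * (1 + M)) * R := by ring
end

section
/- Let Σ ∈ ℝ^{n×n}, λ ≥ 0, μ ∈ ℝⁿ, and let u* ∈ ℝⁿ have two components u*ᵢ ≠ 0 and u*ⱼ ≠ 0 with μᵢ ≠ μⱼ. If (p₁,p₂) and (p₁',p₂') both satisfy the KKT inclusion 0 ∈ Σu* + λ∂‖u*‖₁ + p₁·𝟏ₙ + p₂·μ (respectively with p₁',p₂'), then p₁ = p₁' and p₂ = p₂'. (Uniqueness of the Lagrange multipliers for the machine learning portfolio problem.) -/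
open Finset

/-- Uniqueness of the Lagrange multipliers for the machine learning portfolio problem
`min (1/2)uᵀΣu + λ‖u‖₁  s.t. μᵀu = ρ, 𝟏ₙᵀu = 1`:
if the optimal solution `ustar` has two nonzero components `i ≠ j` with `μ i ≠ μ j`,
then any two pairs of multipliers satisfying the KKT inclusion
`0 ∈ Σ ustar + λ∂‖ustar‖₁ + p₁·𝟏ₙ + p₂·μ` coincide. -/
theorem mlp_multiplier_unique
    (n : ℕ)
    (Sigma : Matrix (Fin n) (Fin n) ℝ)
    (lambda : ℝ) (hlambda : 0 ≤ lambda)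
    (mu : Fin n → ℝ)
    (ustar : Fin n → ℝ)
    (i j : Fin n) (hij : i ≠ j)
    (hui : ustar i ≠ 0) (huj : ustar j ≠ 0) (hmu : mu i ≠ mu j)
    -- the subdifferential of the `ℓ¹`-norm at `ustar`
    (SD : Set (Fin n → ℝ))
    (hSD : SD = {ξ | ∀ k, (ustar k ≠ 0 → ξ k = Real.sign (ustar k)) ∧
      (ustar k = 0 → ξ k ∈ Set.Icc (-1 : ℝ) 1)})
    (p₁ p₂ p₁' p₂' : ℝ)
    (hp : ∃ ξ ∈ SD, ∀ k, Sigma.mulVec ustar k + lambda * ξ k + p₁ + p₂ * mu k = 0)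
    (hp' : ∃ ξ ∈ SD, ∀ k, Sigma.mulVec ustar k + lambda * ξ k + p₁' + p₂' * mu k = 0)
    : p₁ = p₁' ∧ p₂ = p₂' := by
  subst hSD
  obtain ⟨ξ, hξ, h⟩ := hp
  obtain ⟨ξ', hξ', h'⟩ := hp'
  have diff_eq : ∀ k, ustar k ≠ 0 → (p₁ - p₁') + (p₂ - p₂') * mu k = 0 := by
    intro k hk
    have hk₁ := h k
    have hk₂ := h' k
    rw [(hξ k).1 hk] at hk₁
    rw [(hξ' k).1 hk] at hk₂
    linarith
  have hi := diff_eq i hui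
  have hj := diff_eq j huj
  have hmul : (p₂ - p₂') * (mu i - mu j) = 0 := by linarith
  have hp₂ : p₂ - p₂' = 0 := (mul_eq_zero.mp hmul).resolve_right (sub_ne_zero.mpr hmu)
  rw [hp₂, zero_mul, add_zero] at hi
  exact ⟨sub_eq_zero.mp hi, sub_eq_zero.mp hp₂⟩
end
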